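/- arXiv:1602.05681 — 8 statements merged into one kernel-verified Lean document; each statement's English description precedes it below -/
import Mathlib

section
/- Let ε > 0 be real and let DLap(ε) be the discrete Laplace PMF on ℤ. Then for every integer t ≥ 1, the probability DLap(ε)({k ∈ ℤ : |k| ≥ t}) equals 2·exp(−ε·(t − 1))/(exp(ε) + 1). -/
open Real

/-- The mass function of the discrete Laplace distribution with scale `ε`:
`dlap ε k = ((exp ε - 1)/(exp ε + 1)) * exp (-ε * |k|)`. -/
noncomputable def dlap (ε : ℝ) (k : ℤ) : ℝ :=
  (Real.exp ε - 1) / (Real.exp ε + 1) * Real.exp (-ε * |(k : ℝ)|)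

theorem hasSum_geometric_tail {r : ℝ} (hr : 0 ≤ r) (hr1 : r < 1) (c : ℝ) (m : ℕ) :
    HasSum (fun n : ℕ => if m ≤ n then c * r ^ n else 0) (c * r ^ m / (1 - r)) := by
  rw [← hasSum_nat_add_iff' m, Finset.sum_eq_zero
    fun i hi => if_neg (not_le.2 (Finset.mem_range.1 hi)), sub_zero, div_eq_mul_inv]
  refine ((hasSum_geometric_of_lt_one hr hr1).mul_left (c * r ^ m)).congr_fun fun n => ?_
  simp only [Nat.le_add_left, if_true]
  ring

theorem dlap_eq_pow_natAbs (ε : ℝ) (k : ℤ) :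
    dlap ε k = (exp ε - 1) / (exp ε + 1) * exp (-ε) ^ k.natAbs := by
  rw [dlap, ← Real.exp_nat_mul, Nat.cast_natAbs, Int.cast_abs, mul_comm (-ε)]

theorem dlap_nonneg {ε : ℝ} (hε : 0 < ε) (k : ℤ) : 0 ≤ dlap ε k := by
  have : 0 ≤ exp ε - 1 := sub_nonneg.2 (one_le_exp hε.le)
  unfold dlap
  positivity

theorem hasSum_dlap_tail {ε : ℝ} (hε : 0 < ε) (m : ℕ) :
    HasSum (Set.indicator {k : ℤ | (m : ℤ) + 1 ≤ |k|} (dlap ε))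
      (2 * exp (-ε) ^ m / (exp ε + 1)) := by
  have hr1 : exp (-ε) < 1 := exp_lt_one_iff.2 (neg_lt_zero.2 hε)
  have hpos := hasSum_geometric_tail (exp_pos (-ε)).le hr1 ((exp ε - 1) / (exp ε + 1)) (m + 1)
  have hneg := hasSum_geometric_tail (exp_pos (-ε)).le hr1
    ((exp ε - 1) / (exp ε + 1) * exp (-ε)) m
  have hsum := HasSum.of_nat_of_neg_add_one
    (f := Set.indicator {k : ℤ | (m : ℤ) + 1 ≤ |k|} (dlap ε))
    (hpos.congr_fun fun n => by
      simp only [Set.indicator_apply, Set.mem_ofPred_eq, dlap_eq_pow_natAbs, Int.natAbs_natCast]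
      exact if_congr (by rw [Nat.abs_cast]; omega) rfl rfl)
    (hneg.congr_fun fun n => by
      have hn : (-((n : ℤ) + 1)).natAbs = n + 1 := by omega
      simp only [Set.indicator_apply, Set.mem_ofPred_eq, dlap_eq_pow_natAbs, hn]
      exact if_congr (by rw [Int.abs_eq_natAbs, hn]; omega) (by ring) rfl)
  convert hsum using 1
  have hE : exp ε - 1 ≠ 0 := (sub_pos.2 (one_lt_exp_iff.2 hε)).ne'
  have hE' : exp ε + 1 ≠ 0 := by positivity
  have hden : 1 - exp (-ε) = exp (-ε) * (exp ε - 1) := by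
    rw [mul_sub, ← Real.exp_add, neg_add_cancel, Real.exp_zero, mul_one]
  rw [hden]
  field_simp
  ring

/-- Tail probability of the discrete Laplace distribution: for `ε > 0` and any
integer `t ≥ 1`, the probability that `|k| ≥ t` under `DLap(ε)` equals
`2 * exp (-ε * (t - 1)) / (exp ε + 1)`. -/
theorem discrete_laplace_tail (ε : ℝ) (hε : 0 < ε) (μ : PMF ℤ)
    (hμ : ∀ k : ℤ, μ k = ENNReal.ofReal (dlap ε k)) (t : ℤ) (ht : 1 ≤ t) :
    μ.toOuterMeasure {k : ℤ | t ≤ |k|} =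
      ENNReal.ofReal (2 * Real.exp (-ε * ((t : ℝ) - 1)) / (Real.exp ε + 1)) := by
  obtain ⟨m, rfl⟩ : ∃ m : ℕ, t = m + 1 := ⟨(t - 1).toNat, by omega⟩
  have hsum := hasSum_dlap_tail hε m
  have hexp : exp (-ε * (((m + 1 : ℤ) : ℝ) - 1)) = exp (-ε) ^ m := by
    rw [← Real.exp_nat_mul]
    push_cast
    ring_nf
  rw [hexp, ← hsum.tsum_eq, ENNReal.ofReal_tsum_of_nonneg
    (Set.indicator_nonneg fun k _ => dlap_nonneg hε k) hsum.summable, PMF.toOuterMeasure_apply]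
  refine tsum_congr fun k => ?_
  by_cases hk : k ∈ {k : ℤ | (m : ℤ) + 1 ≤ |k|}
  · rw [Set.indicator_of_mem hk, Set.indicator_of_mem hk, hμ]
  · rw [Set.indicator_of_notMem hk, Set.indicator_of_notMem hk, ENNReal.ofReal_zero]
end

section
/- Let ε > 0 be real and β ∈ (0, 1). Then DLap(ε)({k ∈ ℤ : |k| ≥ 1 + (1/ε)·log(1/β)}) < β. In particular, for any real mean e, a sample ν = e + k with k drawn from DLap(ε) satisfies |ν − e| < 1 + (1/ε)·log(1/β) except with probability less than β. -/
open Real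

/-- Tail bound for the discrete Laplace distribution. -/
theorem dlap_tail_le (ε T : ℝ) (hε : 0 < ε) (μ : PMF ℤ)
    (hμ : ∀ k : ℤ, μ k = ENNReal.ofReal (dlap ε k)) :
    μ.toOuterMeasure {k : ℤ | T ≤ |(k : ℝ)|}
      ≤ ENNReal.ofReal (2 * Real.exp (-ε * (T - 1)) / (Real.exp ε + 1)) := by
  have hE : 1 < Real.exp ε := Real.one_lt_exp_iff.mpr hε
  have hr : Real.exp (-ε) < 1 := Real.exp_lt_one_iff.mpr (by linarith)
  set c : ℝ := (Real.exp ε - 1) / (Real.exp ε + 1) with hc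
  have hc0 : 0 ≤ c := div_nonneg (by linarith) (by linarith)
  set n : ℕ := ⌈T⌉₊
  have hn : T ≤ n := Nat.le_ceil T
  have hsub : {k : ℤ | T ≤ |(k : ℝ)|} ⊆
      ⋃ m : ℕ, (({((n + m : ℕ) : ℤ)} : Set ℤ) ∪ {-((n + m : ℕ) : ℤ)}) := by
    intro k hk
    have hk' : n ≤ k.natAbs := by
      apply Nat.ceil_le.mpr
      rw [Nat.cast_natAbs, Int.cast_abs]
      exact hk
    simp only [Set.mem_iUnion, Set.mem_union, Set.mem_singleton_iff]
    exact ⟨k.natAbs - n, by omega⟩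
  have hpt : ∀ (m : ℕ) (k : ℤ), |(k : ℝ)| = n + m →
      μ k ≤ ENNReal.ofReal (c * Real.exp (-ε * T) * Real.exp (-ε) ^ m) := by
    intro m k hk
    rw [hμ, dlap, hk, ← Real.exp_nat_mul, mul_assoc, ← Real.exp_add]
    apply ENNReal.ofReal_le_ofReal
    apply mul_le_mul_of_nonneg_left _ hc0
    apply Real.exp_le_exp.mpr
    nlinarith
  have hterm : ∀ m : ℕ,
      μ.toOuterMeasure (({((n + m : ℕ) : ℤ)} : Set ℤ) ∪ {-((n + m : ℕ) : ℤ)})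
        ≤ ENNReal.ofReal (2 * c * Real.exp (-ε * T) * Real.exp (-ε) ^ m) := by
    intro m
    have hnm : |((n : ℝ) + m)| = n + m := abs_of_nonneg (by positivity)
    refine (MeasureTheory.measure_union_le _ _).trans ?_
    rw [PMF.toOuterMeasure_apply_singleton, PMF.toOuterMeasure_apply_singleton]
    refine (add_le_add (hpt m _ (by push_cast; exact hnm))
      (hpt m _ (by push_cast; rw [abs_neg]; exact hnm))).trans ?_
    rw [← ENNReal.ofReal_add (by positivity) (by positivity)]
    exact ENNReal.ofReal_le_ofReal (le_of_eq (by ring))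
  have hsum : HasSum (fun m : ℕ => 2 * c * Real.exp (-ε * T) * Real.exp (-ε) ^ m)
      (2 * c * Real.exp (-ε * T) * (1 - Real.exp (-ε))⁻¹) :=
    (hasSum_geometric_of_lt_one (Real.exp_pos _).le hr).mul_left _
  calc μ.toOuterMeasure {k : ℤ | T ≤ |(k : ℝ)|}
      ≤ _ := MeasureTheory.measure_mono hsub
    _ ≤ _ := MeasureTheory.measure_iUnion_le _
    _ ≤ _ := ENNReal.tsum_le_tsum hterm
    _ = ENNReal.ofReal (2 * c * Real.exp (-ε * T) * (1 - Real.exp (-ε))⁻¹) := by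
      rw [← ENNReal.ofReal_tsum_of_nonneg (fun m => by positivity) hsum.summable, hsum.tsum_eq]
    _ = _ := by
      congr 1
      have h1 : Real.exp ε - 1 ≠ 0 := by linarith
      have h2 : Real.exp (-ε * (T - 1)) = Real.exp (-ε * T) * Real.exp ε := by
        rw [← Real.exp_add]; ring_nf
      rw [h2, hc, Real.exp_neg ε]
      have h3 : 1 - (Real.exp ε)⁻¹ = (Real.exp ε - 1) / Real.exp ε := by
        field_simp
      rw [h3]
      field_simp

/-- Accuracy of the (discrete) Laplace mechanism: for `ε > 0` and `β ∈ (0,1)`,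
a sample `k` from `DLap(ε)` satisfies `|k| < 1 + (1/ε) * log (1/β)` except with
probability less than `β`; in particular, for any mean `e`, the sample
`ν = e + k` satisfies `|ν - e| < 1 + (1/ε) * log (1/β)` except with
probability less than `β`. -/
theorem discrete_laplace_accuracy (ε β : ℝ) (hε : 0 < ε) (hβ : β ∈ Set.Ioo (0:ℝ) 1)
    (μ : PMF ℤ) (hμ : ∀ k : ℤ, μ k = ENNReal.ofReal (dlap ε k)) :
    μ.toOuterMeasure {k : ℤ | 1 + (1 / ε) * Real.log (1 / β) ≤ |(k : ℝ)|}
        < ENNReal.ofReal β ∧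
    ∀ e : ℝ,
      μ.toOuterMeasure
          {k : ℤ | ¬ |(e + (k : ℝ)) - e| < 1 + (1 / ε) * Real.log (1 / β)}
        < ENNReal.ofReal β := by
  obtain ⟨hβ0, hβ1⟩ := hβ
  have hE : 1 < Real.exp ε := Real.one_lt_exp_iff.mpr hε
  have hL : 0 < Real.log (1 / β) := Real.log_pos ((one_lt_div hβ0).mpr hβ1)
  have key : μ.toOuterMeasure {k : ℤ | 1 + (1 / ε) * Real.log (1 / β) ≤ |(k : ℝ)|}
      < ENNReal.ofReal β := by
    refine (dlap_tail_le ε _ hε μ hμ).trans_lt ?_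
    apply (ENNReal.ofReal_lt_ofReal_iff hβ0).mpr
    have h : -ε * (1 + 1 / ε * Real.log (1 / β) - 1) = Real.log β := by
      rw [one_div β, Real.log_inv]
      field_simp
      ring
    rw [h, Real.exp_log hβ0, div_lt_iff₀ (by linarith)]
    nlinarith
  refine ⟨key, fun e => ?_⟩
  simpa only [add_sub_cancel_left, not_lt] using key
end

section
/- Let M be a type, f g : M → PMF M, let Φ, Φ', Ψ be predicates on M, and let β, β' be extended nonnegative reals. Suppose (i) for every m with Φ m, (f m)({m' : ¬ Φ' m'}) ≤ β, and (ii) for every m' with Φ' m', (g m')({m'' : ¬ Ψ m''}) ≤ β'. Then for every m with Φ m, the monadic composition ((f m).bind g) satisfies ((f m).bind g)({m'' : ¬ Ψ m''}) ≤ β + β'. -/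
/-- The probability of any set under a probability mass function is at most one. -/
theorem PMF.toOuterMeasure_apply_le_one {α : Type*} (p : PMF α) (s : Set α) :
    p.toOuterMeasure s ≤ 1 := by
  rw [PMF.toOuterMeasure_apply, ← p.tsum_coe]
  exact ENNReal.tsum_le_tsum fun x => Set.indicator_le_self s p x

/-- Semantic soundness of the sequencing rule (Seq) of the union-bound Hoare
logic aHL: if from any state satisfying `Φ`, running `f` violates `Φ'` with
probability at most `β`, and from any state satisfying `Φ'`, running `g`
violates `Ψ` with probability at most `β'`, then from any state satisfying
`Φ`, the sequential composition `(f m).bind g` violates `Ψ` with probability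
at most `β + β'`. -/
theorem union_bound_seq {M : Type*} (f g : M → PMF M) (Φ Φ' Ψ : M → Prop)
    (β β' : ENNReal)
    (hf : ∀ m, Φ m → (f m).toOuterMeasure {m' | ¬ Φ' m'} ≤ β)
    (hg : ∀ m', Φ' m' → (g m').toOuterMeasure {m'' | ¬ Ψ m''} ≤ β') :
    ∀ m, Φ m → ((f m).bind g).toOuterMeasure {m'' | ¬ Ψ m''} ≤ β + β' := by
  intro m hm
  rw [PMF.toOuterMeasure_bind_apply]
  calc ∑' a, f m a * (g a).toOuterMeasure {m'' | ¬ Ψ m''}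
      ≤ ∑' a, ({m' | ¬ Φ' m'}.indicator (f m) a + f m a * β') := by
        refine ENNReal.tsum_le_tsum fun a => ?_
        by_cases ha : Φ' a
        · exact le_add_left (mul_le_mul_right (hg a ha) _)
        · rw [Set.indicator_of_mem (show a ∈ {m' | ¬ Φ' m'} from ha)]
          exact le_add_right (mul_le_of_le_one_right' (PMF.toOuterMeasure_apply_le_one _ _))
    _ = (f m).toOuterMeasure {m' | ¬ Φ' m'} + β' := by
        rw [ENNReal.tsum_add, ENNReal.tsum_mul_right, PMF.tsum_coe, one_mul,
          PMF.toOuterMeasure_apply]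
    _ ≤ β + β' := add_le_add_left (hf m hm) _
end

section
/- Let M be a type, f : M → PMF M, Φ a predicate on M, and β an extended nonnegative real such that for every m with Φ m, (f m)({m' : ¬ Φ m'}) ≤ β. Define step : PMF M → PMF M by step μ = μ.bind f. Then for every natural number n and every m with Φ m, the n-fold iterate satisfies (step^[n] (PMF.pure m))({m' : ¬ Φ m'}) ≤ n·β. -/
/-- Union bound for a bind: the event `t` after `p.bind f` is charged either to the event `s`
under `p`, or to `f a` for some `a ∉ s`. -/
theorem PMF.toOuterMeasure_bind_apply_le_add {α γ : Type*} (p : PMF α) (f : α → PMF γ)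
    (s : Set α) (t : Set γ) (β : ENNReal) (hf : ∀ a ∉ s, (f a).toOuterMeasure t ≤ β) :
    (p.bind f).toOuterMeasure t ≤ p.toOuterMeasure s + β := by
  calc (p.bind f).toOuterMeasure t
      = ∑' a, p a * (f a).toOuterMeasure t := PMF.toOuterMeasure_bind_apply p f t
    _ ≤ ∑' a, (s.indicator p a + p a * β) := by
        refine ENNReal.tsum_le_tsum fun a => ?_
        by_cases ha : a ∈ s
        · rw [Set.indicator_of_mem ha]
          exact le_add_right
            (mul_le_of_le_one_right' ((f a).toOuterMeasure_apply_le_one t))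
        · rw [Set.indicator_of_notMem ha, zero_add]
          gcongr
          exact hf a ha
    _ = p.toOuterMeasure s + β := by
        rw [ENNReal.tsum_add, ENNReal.tsum_mul_right, p.tsum_coe, one_mul,
          PMF.toOuterMeasure_apply]

/-- Semantic soundness of the while-loop rule of the union-bound Hoare logic
aHL: if running the loop body `f` from any state satisfying the invariant `Φ`
violates `Φ` with probability at most `β`, then iterating the body `n` times
starting from a state satisfying `Φ` violates `Φ` with probability at most
`n * β`. -/
theorem union_bound_loop {M : Type*} (f : M → PMF M) (Φ : M → Prop) (β : ENNReal)
    (hf : ∀ m, Φ m → (f m).toOuterMeasure {m' | ¬ Φ m'} ≤ β) :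
    ∀ (n : ℕ) (m : M), Φ m →
      ((fun μ : PMF M => μ.bind f)^[n] (PMF.pure m)).toOuterMeasure {m' | ¬ Φ m'}
        ≤ n * β := by
  intro n m hm
  induction n with
  | zero => simp [PMF.toOuterMeasure_pure_apply, hm]
  | succ n ih =>
    rw [Function.iterate_succ_apply', Nat.cast_succ, add_mul, one_mul]
    refine (PMF.toOuterMeasure_bind_apply_le_add _ f {m' | ¬ Φ m'} _ β
      fun a ha => hf a (not_not.mp ha)).trans ?_
    gcongr
end

section
/- Let n ≥ 1 be a natural number, ε > 0 real, β ∈ (0, 1), and let μ be a PMF on (Fin n → ℤ) such that for every i, the pushforward of μ under the evaluation map L ↦ L i is DLap(ε). Then μ({L : ∃ i, |L i| ≥ 1 + (1/ε)·log(n/β)}) < β. -/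
open Real

theorem dlap_of_nat_abs_eq (ε : ℝ) {k : ℤ} {m j : ℕ} (hk : |k| = m + j) :
    dlap ε k = (exp ε - 1) / (exp ε + 1) * exp (-ε * m) * exp (-ε) ^ j := by
  have h : |(k : ℝ)| = m + j := by exact_mod_cast hk
  rw [dlap, h, mul_add, exp_add, mul_comm (-ε) (j : ℝ), exp_nat_mul, mul_assoc]

theorem toOuterMeasure_dlap_tail_nat_le {ε : ℝ} (hε : 0 < ε) (p : PMF ℤ)
    (hp : ∀ k, p k = ENNReal.ofReal (dlap ε k)) (m : ℕ) :
    p.toOuterMeasure {k | (m : ℤ) ≤ |k|}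
      ≤ ENNReal.ofReal (2 * exp ε / (exp ε + 1) * exp (-ε * m)) := by
  have hexp : 1 < exp ε := one_lt_exp_iff.2 hε
  have hr : exp (-ε) < 1 := exp_lt_one_iff.2 (by linarith)
  set c : ℝ := (exp ε - 1) / (exp ε + 1) * exp (-ε * m) with hc
  have hc0 : 0 ≤ c := mul_nonneg (div_nonneg (by linarith) (by linarith)) (exp_pos _).le
  have hgeom := (hasSum_geometric_of_lt_one (exp_pos (-ε)).le hr).mul_left (2 * c)
  have hcover : {k : ℤ | (m : ℤ) ≤ |k|} ⊆ ⋃ j : ℕ, ({(m + j : ℤ)} ∪ {-(m + j : ℤ)}) := by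
    intro k hk
    obtain ⟨j, hj⟩ := Int.le.dest hk
    refine Set.mem_iUnion.2 ⟨j, ?_⟩
    simpa [or_comm] using (abs_eq (by positivity)).1 hj.symm
  have hterm (j : ℕ) : p.toOuterMeasure ({(m + j : ℤ)} ∪ {-(m + j : ℤ)})
      ≤ ENNReal.ofReal (2 * c * exp (-ε) ^ j) := by
    have habs : |(m + j : ℤ)| = m + j := abs_of_nonneg (by positivity)
    refine (MeasureTheory.measure_union_le _ _).trans ?_
    rw [PMF.toOuterMeasure_apply_singleton, PMF.toOuterMeasure_apply_singleton, hp, hp,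
      dlap_of_nat_abs_eq ε habs, dlap_of_nat_abs_eq ε ((abs_neg _).trans habs), ← hc,
      ← ENNReal.ofReal_add (by positivity) (by positivity)]
    exact (congrArg ENNReal.ofReal (by ring)).le
  calc p.toOuterMeasure {k | (m : ℤ) ≤ |k|}
      ≤ ∑' j : ℕ, p.toOuterMeasure ({(m + j : ℤ)} ∪ {-(m + j : ℤ)}) :=
        (MeasureTheory.measure_mono hcover).trans (MeasureTheory.measure_iUnion_le _)
    _ ≤ ∑' j : ℕ, ENNReal.ofReal (2 * c * exp (-ε) ^ j) := ENNReal.tsum_le_tsum hterm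
    _ = ENNReal.ofReal (2 * c * (1 - exp (-ε))⁻¹) := by
        rw [← ENNReal.ofReal_tsum_of_nonneg (fun j => by positivity) hgeom.summable,
          hgeom.tsum_eq]
    _ = ENNReal.ofReal (2 * exp ε / (exp ε + 1) * exp (-ε * m)) := by
        have h1 : exp ε - 1 ≠ 0 := by linarith
        have h2 : (1 - exp (-ε))⁻¹ = exp ε / (exp ε - 1) := by
          rw [exp_neg]
          field_simp
        rw [h2, hc]
        congr 1
        field_simp

theorem toOuterMeasure_dlap_tail_le {ε : ℝ} (hε : 0 < ε) (p : PMF ℤ)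
    (hp : ∀ k, p k = ENNReal.ofReal (dlap ε k)) (t : ℝ) :
    p.toOuterMeasure {k | t ≤ |(k : ℝ)|}
      ≤ ENNReal.ofReal (2 * exp ε / (exp ε + 1) * exp (-ε * t)) := by
  have hsub : {k : ℤ | t ≤ |(k : ℝ)|} ⊆ {k | (⌈t⌉₊ : ℤ) ≤ |k|} := by
    intro k hk
    have h : ⌈t⌉₊ ≤ k.natAbs := Nat.ceil_le.2 (by rwa [Nat.cast_natAbs, Int.cast_abs])
    change (⌈t⌉₊ : ℤ) ≤ |k|
    rw [Int.abs_eq_natAbs]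
    exact_mod_cast h
  refine (MeasureTheory.measure_mono hsub).trans
    ((toOuterMeasure_dlap_tail_nat_le hε p hp _).trans (ENNReal.ofReal_le_ofReal ?_))
  have := Nat.le_ceil t
  gcongr ?_ * exp ?_
  nlinarith

/-- Union bound over `n` Laplace samples: if each coordinate of `μ` is
marginally distributed as `DLap(ε)`, then all `n` coordinates are
simultaneously bounded by `1 + (1/ε) * log (n/β)` except with probability
less than `β`. -/
theorem discrete_laplace_union_bound (n : ℕ) (hn : 1 ≤ n) (ε β : ℝ)
    (hε : 0 < ε) (hβ : β ∈ Set.Ioo (0:ℝ) 1) (μ : PMF (Fin n → ℤ))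
    (hμ : ∀ i : Fin n, ∀ k : ℤ,
      (μ.map (fun L => L i)) k = ENNReal.ofReal (dlap ε k)) :
    μ.toOuterMeasure
        {L : Fin n → ℤ | ∃ i : Fin n,
          1 + (1 / ε) * Real.log ((n : ℝ) / β) ≤ |(L i : ℝ)|}
      < ENNReal.ofReal β := by
  have hβ0 : 0 < β := hβ.1
  have hn0 : (0 : ℝ) < n := by exact_mod_cast hn
  have hexp : 1 < exp ε := one_lt_exp_iff.2 hε
  set t : ℝ := 1 + (1 / ε) * Real.log ((n : ℝ) / β) with ht
  have htail : exp (-ε * t) = (exp ε)⁻¹ * (β / n) := by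
    have h : -ε * t = -ε + -Real.log (n / β) := by
      rw [ht]
      field_simp
      ring
    rw [h, exp_add, exp_neg, exp_neg, exp_log (by positivity), inv_div]
  have hcoord (i : Fin n) : μ.toOuterMeasure {L | t ≤ |(L i : ℝ)|}
      ≤ ENNReal.ofReal (2 * exp ε / (exp ε + 1) * exp (-ε * t)) := by
    have h := toOuterMeasure_dlap_tail_le hε _ (hμ i) t
    rwa [PMF.toOuterMeasure_map_apply] at h
  calc μ.toOuterMeasure {L : Fin n → ℤ | ∃ i : Fin n, t ≤ |(L i : ℝ)|}
      ≤ ∑ i : Fin n, μ.toOuterMeasure {L | t ≤ |(L i : ℝ)|} := by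
        rw [Set.ofPred_exists]
        exact MeasureTheory.measure_iUnion_fintype_le _ _
    _ ≤ ∑ _i : Fin n, ENNReal.ofReal (2 * exp ε / (exp ε + 1) * exp (-ε * t)) :=
        Finset.sum_le_sum fun i _ => hcoord i
    _ = ENNReal.ofReal (2 / (exp ε + 1) * β) := by
        rw [Finset.sum_const, Finset.card_univ, Fintype.card_fin,
          ← ENNReal.ofReal_nsmul, htail, nsmul_eq_mul]
        congr 1
        field_simp
    _ < ENNReal.ofReal β := by
        refine (ENNReal.ofReal_lt_ofReal_iff hβ0).2 (mul_lt_of_lt_one_left hβ0 ?_)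
        rw [div_lt_one (by positivity)]
        linarith
end

section
/- Let Q ≥ 1 be a natural number, ε > 0 real, β ∈ (0, 1), t : ℝ a threshold, and q : Fin Q → ℝ a family of query answers. Let μ be a PMF on ℤ × (Fin Q → ℤ) such that the pushforward of μ under (N₀, N) ↦ N₀ is DLap(ε/2) and, for every i, the pushforward under (N₀, N) ↦ N i is DLap(ε/4). Set α := 2 + (6/ε)·log((Q + 1)/β). Then μ({(N₀, N) : ∃ i, ¬ ((q i + N i ≥ t + N₀ → q i ≥ t − α) ∧ (q i + N i < t + N₀ → q i ≤ t + α))}) < β. -/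
open Real

/-- Tail bound for the discrete Laplace distribution at an integer cutoff. -/
theorem pmf_dlap_tail_le {δ : ℝ} (hδ : 0 < δ) (ν : PMF ℤ)
    (hν : ∀ k, ν k = ENNReal.ofReal (dlap δ k)) (m : ℕ) :
    ν.toOuterMeasure {k : ℤ | (m : ℤ) ≤ |k|} ≤
      ENNReal.ofReal (2 / (Real.exp δ + 1) * Real.exp (δ - δ * m)) := by
  have hcover : {k : ℤ | (m : ℤ) ≤ |k|} ⊆
      ⋃ n : ℕ, ({((m + n : ℕ) : ℤ)} ∪ {-((m + n : ℕ) : ℤ)}) := by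
    intro k hk
    simp only [Set.mem_ofPred_eq, Int.abs_eq_natAbs] at hk
    simp only [Set.mem_iUnion, Set.mem_union, Set.mem_singleton_iff]
    refine ⟨k.natAbs - m, ?_⟩
    omega
  have hr1 : Real.exp (-δ) < 1 := Real.exp_lt_one_iff.2 (neg_lt_zero.2 hδ)
  have he1 : 1 < Real.exp δ := Real.one_lt_exp_iff.2 hδ
  have hee : Real.exp (-δ) = (Real.exp δ)⁻¹ := Real.exp_neg δ
  have hdlap_nonneg (k : ℤ) : 0 ≤ dlap δ k :=
    mul_nonneg (div_nonneg (by linarith) (by linarith)) (Real.exp_pos _).le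
  have hsum : HasSum (fun n : ℕ => dlap δ ((m + n : ℕ) : ℤ) + dlap δ (-((m + n : ℕ) : ℤ)))
      (2 / (Real.exp δ + 1) * Real.exp (δ - δ * m)) := by
    have h := (hasSum_geometric_of_lt_one (Real.exp_pos (-δ)).le hr1).mul_left
      (2 * ((Real.exp δ - 1) / (Real.exp δ + 1)) * Real.exp (-δ * m))
    have hterm (n : ℕ) : dlap δ ((m + n : ℕ) : ℤ) + dlap δ (-((m + n : ℕ) : ℤ)) =
        2 * ((Real.exp δ - 1) / (Real.exp δ + 1)) * Real.exp (-δ * m) * Real.exp (-δ) ^ n := by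
      have habs : |(m : ℝ) + n| = m + n := abs_of_nonneg (by positivity)
      simp only [dlap, Int.cast_neg, Int.cast_add, Int.cast_natCast, abs_neg, Nat.cast_add, habs]
      rw [← Real.exp_nat_mul, mul_assoc _ (Real.exp _) (Real.exp _), ← Real.exp_add,
        show -δ * (m + n) = -δ * m + n * -δ by ring]
      ring
    have hval : 2 / (Real.exp δ + 1) * Real.exp (δ - δ * m) =
        2 * ((Real.exp δ - 1) / (Real.exp δ + 1)) * Real.exp (-δ * m) *
          (1 - Real.exp (-δ))⁻¹ := by
      rw [sub_eq_add_neg δ, Real.exp_add, ← neg_mul, hee]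
      have h1 : Real.exp δ - 1 ≠ 0 := by linarith
      have h2 : Real.exp δ + 1 ≠ 0 := by linarith
      field_simp
    simpa only [hterm, hval] using h
  calc ν.toOuterMeasure {k : ℤ | (m : ℤ) ≤ |k|}
      ≤ ∑' n : ℕ, ν.toOuterMeasure ({((m + n : ℕ) : ℤ)} ∪ {-((m + n : ℕ) : ℤ)}) :=
        (MeasureTheory.measure_mono hcover).trans (MeasureTheory.measure_iUnion_le _)
    _ ≤ ∑' n : ℕ, ENNReal.ofReal
          (dlap δ ((m + n : ℕ) : ℤ) + dlap δ (-((m + n : ℕ) : ℤ))) := by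
        refine ENNReal.tsum_le_tsum fun n => (MeasureTheory.measure_union_le _ _).trans ?_
        rw [PMF.toOuterMeasure_apply_singleton, PMF.toOuterMeasure_apply_singleton, hν, hν,
          ENNReal.ofReal_add (hdlap_nonneg _) (hdlap_nonneg _)]
    _ = _ := by
        rw [← ENNReal.ofReal_tsum_of_nonneg
          (fun n => add_nonneg (hdlap_nonneg _) (hdlap_nonneg _)) hsum.summable, hsum.tsum_eq]

/-- A discrete Laplace variable exceeds `1 + L / δ` in absolute value with probability
less than `exp (-L)`. -/
theorem pmf_dlap_tail_lt {δ L : ℝ} (hδ : 0 < δ) (hL : 0 ≤ L) (ν : PMF ℤ)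
    (hν : ∀ k, ν k = ENNReal.ofReal (dlap δ k)) :
    ν.toOuterMeasure {k : ℤ | 1 + L / δ < |(k : ℝ)|} < ENNReal.ofReal (Real.exp (-L)) := by
  set m : ℕ := ⌊1 + L / δ⌋₊ + 1
  have hm : 1 + L / δ < m := by exact_mod_cast Nat.lt_floor_add_one (1 + L / δ)
  have hsub : {k : ℤ | 1 + L / δ < |(k : ℝ)|} ⊆ {k : ℤ | (m : ℤ) ≤ |k|} := by
    intro k hk
    have hk' : 1 + L / δ < (k.natAbs : ℝ) := by
      simpa [Nat.cast_natAbs] using hk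
    have := (Nat.floor_lt (by positivity)).2 hk'
    simp only [Set.mem_ofPred_eq, Int.abs_eq_natAbs]
    omega
  refine ((MeasureTheory.measure_mono hsub).trans (pmf_dlap_tail_le hδ ν hν m)).trans_lt ?_
  refine (ENNReal.ofReal_lt_ofReal_iff (Real.exp_pos _)).2 ?_
  have he1 : 1 < Real.exp δ := Real.one_lt_exp_iff.2 hδ
  have hfrac : 2 / (Real.exp δ + 1) < 1 := (div_lt_one (by linarith)).2 (by linarith)
  have hexp : Real.exp (δ - δ * m) ≤ Real.exp (-L) := by
    refine Real.exp_le_exp.2 ?_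
    have h := mul_lt_mul_of_pos_left hm hδ
    rw [mul_add, mul_div_cancel₀ _ hδ.ne'] at h
    linarith
  calc 2 / (Real.exp δ + 1) * Real.exp (δ - δ * m) < 1 * Real.exp (δ - δ * m) :=
        mul_lt_mul_of_pos_right hfrac (Real.exp_pos _)
    _ ≤ Real.exp (-L) := by rwa [one_mul]

/-- Accuracy of the (non-adaptive) Sparse Vector algorithm: with threshold
noise `N₀ ~ DLap(ε/2)` and answer noise `N i ~ DLap(ε/4)`, every above/below
threshold report is correct up to error `α = 2 + (6/ε) * log ((Q+1)/β)`,
except with probability less than `β`. -/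
theorem sparse_vector_accuracy (Q : ℕ) (hQ : 1 ≤ Q) (ε β : ℝ)
    (hε : 0 < ε) (hβ : β ∈ Set.Ioo (0:ℝ) 1) (t : ℝ) (q : Fin Q → ℝ)
    (μ : PMF (ℤ × (Fin Q → ℤ)))
    (hμ₀ : ∀ k : ℤ,
      (μ.map (fun p => p.1)) k = ENNReal.ofReal (dlap (ε / 2) k))
    (hμ : ∀ i : Fin Q, ∀ k : ℤ,
      (μ.map (fun p => p.2 i)) k = ENNReal.ofReal (dlap (ε / 4) k)) :
    μ.toOuterMeasure
        {p : ℤ × (Fin Q → ℤ) | ∃ i : Fin Q,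
          ¬ ((q i + (p.2 i : ℝ) ≥ t + (p.1 : ℝ) →
                q i ≥ t - (2 + (6 / ε) * Real.log (((Q : ℝ) + 1) / β))) ∧
             (q i + (p.2 i : ℝ) < t + (p.1 : ℝ) →
                q i ≤ t + (2 + (6 / ε) * Real.log (((Q : ℝ) + 1) / β))))}
      < ENNReal.ofReal β := by
  obtain ⟨hβ0, hβ1⟩ := hβ
  set L : ℝ := Real.log (((Q : ℝ) + 1) / β)
  have hQ0 : (0 : ℝ) ≤ Q := Nat.cast_nonneg Q
  have hL : 0 ≤ L := Real.log_nonneg ((one_le_div hβ0).2 (by linarith))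
  have hexpL : Real.exp (-L) = β / (Q + 1) := by
    rw [Real.exp_neg, Real.exp_log (by positivity), inv_div]
  set A : Set (ℤ × (Fin Q → ℤ)) := {p | 1 + L / (ε / 2) < |(p.1 : ℝ)|}
  set B : Fin Q → Set (ℤ × (Fin Q → ℤ)) := fun i => {p | 1 + L / (ε / 4) < |(p.2 i : ℝ)|}
  have hA : μ.toOuterMeasure A < ENNReal.ofReal (β / (Q + 1)) := by
    have h := pmf_dlap_tail_lt (by positivity) hL _ hμ₀
    rwa [PMF.toOuterMeasure_map_apply, hexpL] at h
  have hB (i : Fin Q) : μ.toOuterMeasure (B i) < ENNReal.ofReal (β / (Q + 1)) := by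
    have h := pmf_dlap_tail_lt (by positivity) hL _ (hμ i)
    rwa [PMF.toOuterMeasure_map_apply, hexpL] at h
  refine (MeasureTheory.measure_mono (t := A ∪ ⋃ i, B i) ?_).trans_lt ?_
  · rintro p ⟨i, hp⟩
    by_contra hout
    simp only [Set.mem_union, Set.mem_iUnion, not_or, not_exists] at hout
    obtain ⟨hpA, hpB⟩ := hout
    have h0 : |(p.1 : ℝ)| ≤ 1 + L / (ε / 2) := not_lt.1 hpA
    have hi : |(p.2 i : ℝ)| ≤ 1 + L / (ε / 4) := not_lt.1 (hpB i)
    rw [abs_le] at h0 hi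
    have hα : (6 / ε) * L = L / (ε / 2) + L / (ε / 4) := by field_simp; ring
    exact hp ⟨fun _ => by linarith, fun _ => by linarith⟩
  · calc μ.toOuterMeasure (A ∪ ⋃ i, B i)
        ≤ μ.toOuterMeasure A + ∑ i, μ.toOuterMeasure (B i) := by
          refine (MeasureTheory.measure_union_le _ _).trans ?_
          gcongr
          exact MeasureTheory.measure_iUnion_fintype_le _ _
      _ < ENNReal.ofReal (β / (Q + 1)) + ∑ _i : Fin Q, ENNReal.ofReal (β / (Q + 1)) :=
          ENNReal.add_lt_add_of_lt_of_le
            (ENNReal.sum_ne_top.2 fun i _ => (hB i).ne_top) hA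
            (Finset.sum_le_sum fun i _ => (hB i).le)
      _ = ENNReal.ofReal β := by
          rw [← ENNReal.ofReal_sum_of_nonneg fun _ _ => by positivity,
            ← ENNReal.ofReal_add (by positivity) (by positivity)]
          congr 1
          simp only [Finset.sum_const, Finset.card_univ, Fintype.card_fin, nsmul_eq_mul]
          field_simp
          ring
end

section
/- Let ε > 0 real, β ∈ (0, 1), and let t, T, q be real numbers with |T − t| ≤ c₁ for some real c₁ ≥ 0. Set c₂ := 1 + (4/ε)·log(1/β). Then DLap(ε/4)({N ∈ ℤ : ¬ ((q + N ≥ T → q ≥ t − (c₁ + c₂)) ∧ (q + N < T → q ≤ t + (c₁ + c₂)))}) < β. -/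
open Real

/-- The mass the discrete Laplace distribution puts on a tail `±{m, m + 1, …}`, presented as the
range of a sequence `f` with `|f n| = m + n`. -/
lemma toOuterMeasure_range_of_dlap {a : ℝ} (ha : 0 < a) {μ : PMF ℤ}
    (hμ : ∀ k : ℤ, μ k = ENNReal.ofReal (dlap a k)) (m : ℕ) {f : ℕ → ℤ}
    (hf : ∀ n, |f n| = (m : ℤ) + n) :
    μ.toOuterMeasure (Set.range f) =
      ENNReal.ofReal (exp (-a * m + a) / (exp a + 1)) := by
  have hinj : Function.Injective f := fun i j hij => by
    have hi := hf i
    rw [hij, hf j] at hi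
    omega
  have hexp : 1 < exp a := one_lt_exp_iff.mpr ha
  have hr : exp (-a) < 1 := exp_lt_one_iff.mpr (neg_lt_zero.mpr ha)
  have hdlap : ∀ n, dlap a (f n) =
      (exp a - 1) / (exp a + 1) * exp (-a * m) * exp (-a) ^ n := fun n => by
    have habs : |(f n : ℝ)| = m + n := mod_cast hf n
    rw [dlap, habs, ← exp_nat_mul, mul_assoc, ← exp_add]
    ring_nf
  have hsum := (hasSum_geometric_of_lt_one (exp_pos (-a)).le hr).mul_left
    ((exp a - 1) / (exp a + 1) * exp (-a * m))
  have hnonneg : ∀ n : ℕ, 0 ≤ (exp a - 1) / (exp a + 1) * exp (-a * m) * exp (-a) ^ n :=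
    fun n => by
      have : 0 ≤ exp a - 1 := by linarith
      positivity
  rw [PMF.toOuterMeasure_apply, ← tsum_subtype, tsum_range (fun k => μ k) hinj]
  simp_rw [hμ, hdlap]
  rw [← ENNReal.ofReal_tsum_of_nonneg hnonneg hsum.summable, hsum.tsum_eq, exp_add, exp_neg a]
  have : exp a - 1 ≠ 0 := by linarith
  congr 1
  field_simp

/-- Specification of one step of the interactive Sparse Vector algorithm:
assuming the noisy threshold `T` is within `c₁` of the true threshold `t`, an
above/below threshold report computed from the noisy answer `q + N` with
`N ~ DLap(ε/4)` is correct up to error `c₁ + c₂` with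
`c₂ = 1 + (4/ε) * log (1/β)`, except with probability less than `β`. -/
theorem sparse_vector_step (ε β : ℝ) (hε : 0 < ε) (hβ : β ∈ Set.Ioo (0:ℝ) 1)
    (t T q c₁ : ℝ) (hc₁ : 0 ≤ c₁) (hT : |T - t| ≤ c₁)
    (μ : PMF ℤ) (hμ : ∀ k : ℤ, μ k = ENNReal.ofReal (dlap (ε / 4) k)) :
    μ.toOuterMeasure
        {N : ℤ |
          ¬ ((q + (N : ℝ) ≥ T →
                q ≥ t - (c₁ + (1 + (4 / ε) * Real.log (1 / β)))) ∧
             (q + (N : ℝ) < T →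
                q ≤ t + (c₁ + (1 + (4 / ε) * Real.log (1 / β)))))}
      < ENNReal.ofReal β := by
  obtain ⟨hβ₀, hβ₁⟩ := hβ
  set c₂ := 1 + (4 / ε) * Real.log (1 / β) with hc₂
  set m := ⌈c₂⌉₊
  have hm : c₂ ≤ m := Nat.le_ceil c₂
  have ha : 0 < ε / 4 := by positivity
  have hlog : 0 < log (1 / β) := log_pos ((one_lt_div hβ₀).mpr hβ₁)
  have hc₂_nonneg : 0 ≤ c₂ := by positivity
  obtain ⟨hT₁, hT₂⟩ := abs_le.mp hT
  have htail : ENNReal.ofReal (exp (-(ε / 4) * m + ε / 4) / (exp (ε / 4) + 1)) <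
      ENNReal.ofReal β := by
    refine (ENNReal.ofReal_lt_ofReal_iff hβ₀).mpr ?_
    have hle : exp (-(ε / 4) * m + ε / 4) ≤ β := by
      rw [← le_log_iff_exp_le hβ₀]
      have h₁ : ε / 4 * c₂ = ε / 4 - log β := by
        rw [hc₂, one_div, log_inv]
        field_simp
        ring
      have h₂ := mul_le_mul_of_nonneg_left hm ha.le
      linarith
    have hexp := exp_pos (ε / 4)
    rw [div_lt_iff₀ (by positivity)]
    nlinarith
  rcases lt_or_ge q t with hq | hq
  · rw [← toOuterMeasure_range_of_dlap ha hμ m (f := fun n => (m : ℤ) + n)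
      fun n => abs_of_nonneg (by positivity)] at htail
    refine (MeasureTheory.measure_mono fun N hN => ?_).trans_lt htail
    have hN' : (m : ℤ) ≤ N := by
      suffices c₂ ≤ N from Int.natCast_ceil_eq_ceil hc₂_nonneg ▸ Int.ceil_le.mpr this
      by_contra! h
      exact hN ⟨fun _ => by linarith, fun _ => by linarith⟩
    exact ⟨(N - m).toNat, by dsimp only; omega⟩
  · rw [← toOuterMeasure_range_of_dlap ha hμ m (f := fun n => -((m : ℤ) + n))
      fun n => by rw [abs_neg, abs_of_nonneg (by positivity)]] at htail
    refine (MeasureTheory.measure_mono fun N hN => ?_).trans_lt htail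
    have hN' : (m : ℤ) ≤ -N := by
      suffices c₂ ≤ ((-N : ℤ) : ℝ) from
        Int.natCast_ceil_eq_ceil hc₂_nonneg ▸ Int.ceil_le.mpr this
      by_contra! h
      push_cast at h
      exact hN ⟨fun _ => by linarith, fun _ => by linarith⟩
    exact ⟨(-N - m).toNat, by dsimp only; omega⟩
end

section
/- Let X be a finite nonempty type; let x, d : X → ℝ be probability vectors (nonnegative entries summing to 1) with x i > 0 for all i; let u : X → ℝ with 0 ≤ u i ≤ 1 for all i; and let η be real with 0 < η ≤ 1. Define w i := x i · exp(−η · u i), W := ∑_{i ∈ X} w i, and x' i := w i / W. Then, with Ψ(y, d) := ∑_{i ∈ X} d i · log(d i / y i), we have Ψ(x, d) − Ψ(x', d) ≥ η·(∑_{i ∈ X} u i · x i − ∑_{i ∈ X} u i · d i) − η². -/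
open Real

/-- Reweighting `x` by `exp ∘ f` and normalizing changes the relative entropy of `d` by the
`d`-average of `f` minus the logarithm of the normalizing constant. -/
lemma relEntropy_sub_relEntropy_reweight {X : Type*} [Fintype X]
    (x d : X → ℝ) (hx : ∀ i, 0 < x i) (hdsum : ∑ i, d i = 1)
    (f : X → ℝ) {W : ℝ} (hW : 0 < W) :
    (∑ i, d i * Real.log (d i / x i)) -
        (∑ i, d i * Real.log (d i / (x i * Real.exp (f i) / W)))
      = (∑ i, d i * f i) - Real.log W := by
  have hterm (i : X) : d i * Real.log (d i / x i) -
      d i * Real.log (d i / (x i * Real.exp (f i) / W)) = d i * f i - d i * Real.log W := by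
    rcases eq_or_ne (d i) 0 with h | h
    · simp [h]
    · have hxi := (hx i).ne'
      have he := (Real.exp_pos (f i)).ne'
      rw [Real.log_div h hxi, Real.log_div h (div_ne_zero (mul_ne_zero hxi he) hW.ne'),
        Real.log_div (mul_ne_zero hxi he) hW.ne', Real.log_mul hxi he, Real.log_exp]
      ring
  rw [← Finset.sum_sub_distrib, Finset.sum_congr rfl fun i _ => hterm i,
    Finset.sum_sub_distrib, ← Finset.sum_mul, hdsum, one_mul]

lemma exp_neg_mul_le {η t : ℝ} (hη : 0 ≤ η) (hη1 : η ≤ 1) (ht : 0 ≤ t) (ht1 : t ≤ 1) :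
    Real.exp (-η * t) ≤ 1 - η * t + η ^ 2 := by
  have h0 : 0 ≤ η * t := mul_nonneg hη ht
  have h1 : η * t ≤ η := mul_le_of_le_one_right hη ht1
  have habs : |-η * t| ≤ 1 := by
    rw [neg_mul, abs_neg, abs_of_nonneg h0]
    exact h1.trans hη1
  have hexp := (abs_le.mp (Real.abs_exp_sub_one_sub_id_le habs)).2
  have hsq : (η * t) ^ 2 ≤ η ^ 2 := pow_le_pow_left₀ h0 h1 2
  linarith [show (-η * t) ^ 2 = (η * t) ^ 2 by ring]

lemma log_sum_mul_exp_neg_le {X : Type*} [Fintype X] [Nonempty X]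
    (x : X → ℝ) (hx : ∀ i, 0 < x i) (hxsum : ∑ i, x i = 1)
    (u : X → ℝ) (hu : ∀ i, 0 ≤ u i ∧ u i ≤ 1) {η : ℝ} (hη : 0 ≤ η) (hη1 : η ≤ 1) :
    Real.log (∑ i, x i * Real.exp (-η * u i)) ≤ -(η * ∑ i, u i * x i) + η ^ 2 := by
  have hW : 0 < ∑ i, x i * Real.exp (-η * u i) :=
    Finset.sum_pos (fun i _ => mul_pos (hx i) (Real.exp_pos _)) Finset.univ_nonempty
  have hle : ∑ i, x i * Real.exp (-η * u i) ≤ 1 - η * ∑ i, u i * x i + η ^ 2 :=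
    calc ∑ i, x i * Real.exp (-η * u i)
        ≤ ∑ i, x i * (1 - η * u i + η ^ 2) := Finset.sum_le_sum fun i _ =>
          mul_le_mul_of_nonneg_left (exp_neg_mul_le hη hη1 (hu i).1 (hu i).2) (hx i).le
      _ = ∑ i, (x i * (1 + η ^ 2) - η * (u i * x i)) :=
          Finset.sum_congr rfl fun i _ => by ring
      _ = 1 - η * ∑ i, u i * x i + η ^ 2 := by
          rw [Finset.sum_sub_distrib, ← Finset.sum_mul, ← Finset.mul_sum, hxsum]
          ring
  linarith [Real.log_le_sub_one_of_pos hW]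

/-- Potential decrease for the multiplicative weights update rule: for
probability vectors `x` (with positive entries) and `d` on a finite nonempty
type `X`, a query `u` with values in `[0,1]`, and a learning rate
`0 < η ≤ 1`, the multiplicative weights update
`x' i = x i * exp (-η * u i) / W` decreases the relative-entropy potential
`Ψ(y, d) = ∑ i, d i * log (d i / y i)` by at least
`η * (∑ i, u i * x i - ∑ i, u i * d i) - η ^ 2`. -/
theorem mw_step_potential_decrease {X : Type*} [Fintype X] [Nonempty X]
    (x d : X → ℝ) (hx : ∀ i, 0 < x i) (hxsum : ∑ i, x i = 1)
    (hd : ∀ i, 0 ≤ d i) (hdsum : ∑ i, d i = 1)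
    (u : X → ℝ) (hu : ∀ i, 0 ≤ u i ∧ u i ≤ 1)
    (η : ℝ) (hη : 0 < η) (hη1 : η ≤ 1) :
    (∑ i, d i * Real.log (d i / x i)) -
        (∑ i, d i * Real.log (d i /
          (x i * Real.exp (-η * u i) / (∑ j, x j * Real.exp (-η * u j)))))
      ≥ η * ((∑ i, u i * x i) - ∑ i, u i * d i) - η ^ 2 := by
  have hW : 0 < ∑ j, x j * Real.exp (-η * u j) :=
    Finset.sum_pos (fun i _ => mul_pos (hx i) (Real.exp_pos _)) Finset.univ_nonempty
  have hlogW := log_sum_mul_exp_neg_le x hx hxsum u hu hη.le hη1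
  have hdiff := relEntropy_sub_relEntropy_reweight x d hx hdsum (fun i => -η * u i) hW
  have hud : ∑ i, d i * (-η * u i) = -(η * ∑ i, u i * d i) := by
    rw [Finset.mul_sum, ← Finset.sum_neg_distrib]
    exact Finset.sum_congr rfl fun i _ => by ring
  linarith
end
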